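/- arXiv:1107.4599 — 2 statements merged into one kernel-verified Lean document; each statement's English description precedes it below -/
import Mathlib

section
/- Let (C̄,∂₀) be a chain complex of finite-dimensional K-vector spaces and (C,∂) a quantum correction of gap at least μ. For each k: rank(∂₀|_{C̄_{k+1}}) ≤ rank(∂|_{C_{k+1}}); if these ranks are equal then b_k(C,∂) = 0; and if rank(∂₀|_{C̄_{k+1}}) < rank(∂|_{C_{k+1}}) then b_k(C,∂) ≥ μ(k). -/
noncomputable section
open Classical in
/-- The valuation `ν(Σ a_g T^g) = min {g : a_g ≠ 0}` (with `ν 0 = ∞`) on the Novikov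
field `Λ = Λ^{K,Γ}` (realized inside the Hahn series field). -/
def novikovVal {K : Type*} [Field K] {Γ : AddSubgroup ℝ} (a : HahnSeries Γ K) : EReal :=
  if a = 0 then ⊤ else ((a.order : ℝ) : EReal)

/-- A quantum correction `(C,∂)` of gap at least `μ` of a chain complex `(C̄,∂₀)` of
finite-dimensional `K`-vector spaces graded by a set `S` with `ℤ`-action, over the
Novikov field `Λ = Λ^{K,Γ}`, presented internally: `C = ⊕_{k} C_k` is a `Λ`-module, each
`C̄_k ⊆ C_k` is a finite-dimensional `K`-subspace with a `K`-basis which is also a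
`Λ`-basis of `C_k` (so `C_k = C̄_k ⊗_K Λ`), `∂` is `Λ`-linear of degree `−1`, `∂₀` is
`K`-linear of degree `−1` on `C̄`, and `(∂ − ∂₀ ⊗ 1)(C̄_{k+1})` is contained in
`T^{μ(k)}(C̄_k ⊗_K Λ_{≥0})`, the additive group generated by `λ • x` with `x ∈ C̄_k` and
`ν(λ) ≥ μ(k)`, where `μ : S → Γ ∩ (0,∞)`. -/
structure QuantumCorrection (K : Type*) [Field K] (Γ : AddSubgroup ℝ)
    (S : Type*) [AddAction ℤ S] where
  C : Type*
  [acg : AddCommGroup C]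
  [modL : Module (HahnSeries Γ K) C]
  [modK : Module K C]
  [tower : IsScalarTower K (HahnSeries Γ K) C]
  grading : S → Submodule (HahnSeries Γ K) C
  grading_indep : ∀ k : S, Disjoint (grading k) (⨆ j ∈ {j : S | j ≠ k}, grading j)
  grading_total : (⨆ k, grading k) = ⊤
  gbar : S → Submodule K C
  lattice : ∀ k : S, ∃ (n : ℕ) (v : Fin n → C),
    (∀ i, v i ∈ gbar k) ∧ Submodule.span K (Set.range v) = gbar k ∧
    LinearIndependent K v ∧
    Submodule.span (HahnSeries Γ K) (Set.range v) = grading k ∧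
    LinearIndependent (HahnSeries Γ K) v
  d : C →ₗ[HahnSeries Γ K] C
  d_sq : ∀ x, d (d x) = 0
  d_grading : ∀ k : S, (grading k).map d ≤ grading ((-1 : ℤ) +ᵥ k)
  d0 : C →ₗ[K] C
  d0_sq : ∀ x, d0 (d0 x) = 0
  d0_gbar : ∀ k : S, (gbar k).map d0 ≤ gbar ((-1 : ℤ) +ᵥ k)
  μ : S → ℝ
  μ_pos : ∀ k, 0 < μ k
  μ_mem : ∀ k, μ k ∈ Γ
  gap : ∀ (k : S), ∀ x ∈ gbar ((1 : ℤ) +ᵥ k), d x - d0 x ∈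
    AddSubgroup.closure {y : C | ∃ (lam : HahnSeries Γ K) (z : C), z ∈ gbar k ∧
      ((μ k : ℝ) : EReal) ≤ novikovVal lam ∧ y = lam • z}

attribute [instance] QuantumCorrection.acg QuantumCorrection.modL QuantumCorrection.modK
  QuantumCorrection.tower

namespace QuantumCorrection

variable {K : Type*} [Field K] {Γ : AddSubgroup ℝ} {S : Type*} [AddAction ℤ S]

/-- `ν̄(x) = sup {m ∈ ℝ : x ∈ T^m(C̄ ⊗_K Λ_{≥0})}`, where `C̄ = ⊕_k C̄_k` and
`T^m(C̄ ⊗_K Λ_{≥0})` is the additive group generated by the `λ • z` with `z ∈ C̄` and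
`ν(λ) ≥ m`. -/
def nubar (X : QuantumCorrection K Γ S) (y : X.C) : EReal :=
  sSup {e : EReal | ∃ m : ℝ, e = (m : EReal) ∧
    y ∈ AddSubgroup.closure {y' : X.C | ∃ (lam : HahnSeries Γ K) (z : X.C),
      z ∈ (⨆ k, X.gbar k : Submodule K X.C) ∧ (m : EReal) ≤ novikovVal lam ∧ y' = lam • z}}

/-- The induced filtration: `C_k^λ = {x ∈ C_k : −ν̄(x) ≤ λ}`. -/
def filt (X : QuantumCorrection K Γ S) (k : S) (lam : ℝ) : Set X.C :=
  {y : X.C | y ∈ X.grading k ∧ ((-lam : ℝ) : EReal) ≤ X.nubar y}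

/-- The boundary depth in grading `k`:
`b_k(C,∂) = inf {β ≥ 0 : ∀ λ, (Im ∂) ∩ C_k^λ ⊆ ∂(C_{k+1}^{λ+β})}`, valued in
`[0,∞] ⊆ EReal`. -/
def bdepth (X : QuantumCorrection K Γ S) (k : S) : EReal :=
  sInf {e : EReal | ∃ β : ℝ, e = (β : EReal) ∧ 0 ≤ β ∧
    ∀ (lam : ℝ) (x : X.C), x ∈ X.filt k lam → (∃ y, X.d y = x) →
      ∃ y ∈ X.filt ((1 : ℤ) +ᵥ k) (lam + β), X.d y = x}

/-- `dim_Λ H_k(C,∂)`, computed as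
`dim (ker ∂ ∩ C_k) − dim (Im ∂ ∩ C_k)`. -/
def hdimL (X : QuantumCorrection K Γ S) (k : S) : ℕ :=
  Module.finrank (HahnSeries Γ K) ↥(LinearMap.ker X.d ⊓ X.grading k) -
    Module.finrank (HahnSeries Γ K) ↥(LinearMap.range X.d ⊓ X.grading k)

/-- `dim_K H_k(C̄,∂₀)`, computed as `dim (ker ∂₀ ∩ C̄_k) − dim (Im ∂₀ ∩ C̄_k)`. -/
def hdimK (X : QuantumCorrection K Γ S) (k : S) : ℕ :=
  Module.finrank K ↥(LinearMap.ker X.d0 ⊓ X.gbar k) -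
    Module.finrank K ↥(LinearMap.range X.d0 ⊓ X.gbar k)

theorem coe_le_novikovVal_iff {a : HahnSeries Γ K} {m : ℝ} :
    (m : EReal) ≤ novikovVal a ↔ ∀ g : Γ, (g : ℝ) < m → a.coeff g = 0 := by
  unfold novikovVal
  split_ifs with h
  · simp [h]
  · rw [EReal.coe_le_coe_iff]
    refine ⟨fun hm g hg => HahnSeries.coeff_eq_zero_of_lt_order ?_, fun hm => ?_⟩
    · exact_mod_cast hg.trans_le hm
    · by_contra! hlt
      exact HahnSeries.coeff_order_eq_zero.not.mpr h (hm _ hlt)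

theorem coeff_mul_eq_zero_of_lt_add {a b : HahnSeries Γ K} {m m' : ℝ}
    (ha : ∀ g : Γ, (g : ℝ) < m → a.coeff g = 0) (hb : ∀ g : Γ, (g : ℝ) < m' → b.coeff g = 0)
    (g : Γ) (hg : (g : ℝ) < m + m') : (a * b).coeff g = 0 := by
  rw [HahnSeries.coeff_mul]
  refine Finset.sum_eq_zero fun ij hij => ?_
  rw [Finset.mem_antidiagonal] at hij
  have hsum : (ij.1 : ℝ) + ij.2 = g := by exact_mod_cast congrArg Subtype.val hij.2.2
  by_cases h : (ij.1 : ℝ) < m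
  · rw [ha _ h, zero_mul]
  · rw [hb _ (by linarith), mul_zero]

/-- The vector of coefficients of `T^g` in a vector of Hahn series. -/
def coeffs {ι : Type*} (g : Γ) : (ι → HahnSeries Γ K) →ₗ[K] (ι → K) where
  toFun x i := (x i).coeff g
  map_add' _ _ := rfl
  map_smul' _ _ := rfl

@[simp]
theorem coeffs_apply {ι : Type*} (g : Γ) (x : ι → HahnSeries Γ K) (i : ι) :
    coeffs g x i = (x i).coeff g := rfl

/-- All entries of the vector `x` have valuation at least `m`. -/
def VanishesBelow {ι : Type*} (m : ℝ) (x : ι → HahnSeries Γ K) : Prop :=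
  ∀ g : Γ, (g : ℝ) < m → coeffs g x = 0

theorem exists_vanishesBelow_coeffs_ne_zero {ι : Type*} [Finite ι] {x : ι → HahnSeries Γ K}
    (hx : x ≠ 0) : ∃ g : Γ, VanishesBelow (g : ℝ) x ∧ coeffs g x ≠ 0 := by
  obtain ⟨i₀, hi₀⟩ := Function.ne_iff.mp hx
  obtain ⟨i, hi, hmin⟩ := Set.exists_min_image {i | x i ≠ 0} (fun i => (x i).order)
    (Set.toFinite _) ⟨i₀, hi₀⟩
  refine ⟨(x i).order, fun g hg => funext fun j => ?_, fun h => ?_⟩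
  · by_cases hj : x j = 0
    · simp [hj]
    · exact HahnSeries.coeff_eq_zero_of_lt_order (lt_of_lt_of_le (by exact_mod_cast hg) (hmin j hj))
  · exact hi (HahnSeries.coeff_order_eq_zero.mp (congrFun h i))

/-- Extension of scalars of a linear map from `K` to the Novikov field. -/
def extendScalars {ι κ : Type*} [Fintype ι] [DecidableEq ι] (L : (ι → K) →ₗ[K] (κ → K)) :
    (ι → HahnSeries Γ K) →ₗ[HahnSeries Γ K] (κ → HahnSeries Γ K) :=
  ((LinearMap.toMatrix' L).map HahnSeries.C).mulVecLin

theorem coeffs_extendScalars {ι κ : Type*} [Fintype ι] [DecidableEq ι]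
    (L : (ι → K) →ₗ[K] (κ → K)) (g : Γ) (x : ι → HahnSeries Γ K) :
    coeffs g (extendScalars L x) = L (coeffs g x) := by
  rw [← LinearMap.toMatrix'_mulVec L]
  ext i
  simp [extendScalars, Matrix.mulVec, dotProduct, HahnSeries.coeff_sum, HahnSeries.C_apply]

theorem VanishesBelow.extendScalars {ι κ : Type*} [Fintype ι] [DecidableEq ι]
    (L : (ι → K) →ₗ[K] (κ → K)) {m : ℝ} {x : ι → HahnSeries Γ K} (hx : VanishesBelow m x) :
    VanishesBelow m (extendScalars L x) := fun g hg => by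
  rw [coeffs_extendScalars, hx g hg, map_zero]

/-- `D` agrees with the extension of scalars of `A` up to terms raising the valuation by at
least `μ`. -/
def IsCorrection {ι κ : Type*} (A : (ι → K) →ₗ[K] (κ → K))
    (D : (ι → HahnSeries Γ K) →ₗ[HahnSeries Γ K] (κ → HahnSeries Γ K)) (μ : ℝ) : Prop :=
  ∀ (m : ℝ) (y : ι → HahnSeries Γ K), VanishesBelow m y →
    ∀ g : Γ, (g : ℝ) < m + μ → coeffs g (D y) = A (coeffs g y)

section IsCorrection

variable {ι κ : Type*} [Fintype ι]
  {A : (ι → K) →ₗ[K] (κ → K)}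
  {D : (ι → HahnSeries Γ K) →ₗ[HahnSeries Γ K] (κ → HahnSeries Γ K)} {μ : ℝ}

theorem IsCorrection.exists_section (h : IsCorrection A D μ) (hμ : 0 < μ) :
    ∃ W : (Fin (Module.finrank K (LinearMap.range A)) → HahnSeries Γ K) →ₗ[HahnSeries Γ K]
        (ι → HahnSeries Γ K),
      Function.Injective (D ∘ₗ W) ∧
      ∀ m c, VanishesBelow m (D (W c)) → VanishesBelow m (W c) := by
  obtain ⟨s, hs⟩ := A.rangeRestrict.exists_rightInverse_of_surjective A.range_rangeRestrict
  let b := Module.finBasis K (LinearMap.range A)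
  let W₀ := s ∘ₗ b.equivFun.symm.toLinearMap
  have hAW : ∀ c, A (W₀ c) = b.equivFun.symm c := fun c =>
    congrArg Subtype.val (LinearMap.congr_fun hs (b.equivFun.symm c))
  have hinj : ∀ c, A (W₀ c) = 0 → c = 0 := fun c hc => by
    rw [hAW, ZeroMemClass.coe_eq_zero] at hc
    exact (LinearEquiv.map_eq_zero_iff _).mp hc
  have key : ∀ (g : Γ) c, VanishesBelow (g : ℝ) c →
      coeffs g (D (extendScalars W₀ c)) = A (W₀ (coeffs g c)) := fun g c hc => by
    rw [h g _ (hc.extendScalars W₀) g (by linarith), coeffs_extendScalars]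
  refine ⟨extendScalars W₀, ?_, fun m c hc => ?_⟩
  · refine (injective_iff_map_eq_zero _).mpr fun c hc => ?_
    by_contra hne
    obtain ⟨g, hg, hg'⟩ := exists_vanishesBelow_coeffs_ne_zero hne
    refine hg' (hinj _ ?_)
    rw [← key g c hg, ← LinearMap.comp_apply, hc, map_zero]
  · by_cases hne : c = 0
    · intro g _
      simp [hne]
    obtain ⟨g, hg, hg'⟩ := exists_vanishesBelow_coeffs_ne_zero hne
    have hmg : m ≤ g := by
      by_contra! hlt
      exact hg' (hinj _ (by rw [← key g c hg, hc g hlt]))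
    exact VanishesBelow.extendScalars W₀ fun g' hg' => hg g' (hg'.trans_le hmg)

theorem IsCorrection.finrank_range_le [Finite κ] (h : IsCorrection A D μ) (hμ : 0 < μ) :
    Module.finrank K (LinearMap.range A) ≤
      Module.finrank (HahnSeries Γ K) (LinearMap.range D) := by
  obtain ⟨W, hW, -⟩ := h.exists_section hμ
  have := LinearMap.finrank_range_of_inj hW
  rw [Module.finrank_fin_fun] at this
  exact this ▸ Submodule.finrank_mono (LinearMap.range_comp_le_range W D)

theorem IsCorrection.exists_preimage_of_finrank_eq [Finite κ] (h : IsCorrection A D μ) (hμ : 0 < μ)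
    (heq : Module.finrank K (LinearMap.range A) =
      Module.finrank (HahnSeries Γ K) (LinearMap.range D))
    {m : ℝ} {x : κ → HahnSeries Γ K} (hx : x ∈ LinearMap.range D) (hm : VanishesBelow m x) :
    ∃ y, VanishesBelow m y ∧ D y = x := by
  obtain ⟨W, hW, hW'⟩ := h.exists_section hμ
  have hrank := LinearMap.finrank_range_of_inj hW
  rw [Module.finrank_fin_fun] at hrank
  rw [← Submodule.eq_of_le_of_finrank_eq (LinearMap.range_comp_le_range W D)
    (hrank.trans heq)] at hx
  obtain ⟨c, rfl⟩ := hx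
  exact ⟨W c, hW' m c hm, rfl⟩

theorem IsCorrection.finrank_range_le_of_forall_exists_preimage [Fintype κ]
    (h : IsCorrection A D μ) {β : ℝ} (hβ : β < μ)
    (hpre : ∀ m, ∀ x ∈ LinearMap.range D, VanishesBelow m x →
      ∃ y, VanishesBelow (m - β) y ∧ D y = x) :
    Module.finrank (HahnSeries Γ K) (LinearMap.range D) ≤
      Module.finrank K (LinearMap.range A) := by
  classical
  obtain ⟨p, hp⟩ := (LinearMap.range A).subtype.exists_leftInverse_of_injective
    (Submodule.ker_subtype _)
  let b := Module.finBasis K (LinearMap.range A)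
  let P := b.equivFun.toLinearMap ∘ₗ p
  have hP : ∀ x ∈ LinearMap.range A, P x = 0 → x = 0 := fun x hx h0 => by
    have hpx : p x = ⟨x, hx⟩ := LinearMap.congr_fun hp ⟨x, hx⟩
    have h0' : b.equivFun (p x) = 0 := h0
    rw [LinearEquiv.map_eq_zero_iff, hpx] at h0'
    exact congrArg Subtype.val h0'
  have hinj : Function.Injective
      ((extendScalars P : _ →ₗ[HahnSeries Γ K] _).domRestrict (LinearMap.range D)) := by
    refine (injective_iff_map_eq_zero _).mpr fun x hx => ?_
    by_contra hne
    obtain ⟨g, hg, hg'⟩ := exists_vanishesBelow_coeffs_ne_zero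
      (x := (x : κ → HahnSeries Γ K)) (by simpa using hne)
    obtain ⟨y, hy, hyx⟩ := hpre g x x.2 hg
    refine hg' (hP _ ⟨coeffs g y, ?_⟩ ?_)
    · rw [← hyx, h _ y hy g (by linarith)]
    · rw [← coeffs_extendScalars]
      rw [LinearMap.domRestrict_apply] at hx
      rw [hx, map_zero]
  simpa using LinearMap.finrank_le_finrank_of_injective hinj

end IsCorrection

theorem smul_eq_C_smul (X : QuantumCorrection K Γ S) (a : K) (x : X.C) :
    a • x = (HahnSeries.C a : HahnSeries Γ K) • x := by
  rw [← mul_one (HahnSeries.C a : HahnSeries Γ K), HahnSeries.C_mul_eq_smul, smul_assoc, one_smul]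

/-- A `K`-basis `vec` of `C̄_k` which is a `Λ`-basis of `C_k`, together with the resulting
coordinates, extended by zero to the other graded pieces. -/
structure Frame (X : QuantumCorrection K Γ S) (k : S) where
  n : ℕ
  vec : Fin n → X.C
  coord : X.C →ₗ[HahnSeries Γ K] (Fin n → HahnSeries Γ K)
  span_gbar : Submodule.span K (Set.range vec) = X.gbar k
  span_grading : Submodule.span (HahnSeries Γ K) (Set.range vec) = X.grading k
  coord_linearCombination : ∀ c, coord (Fintype.linearCombination (HahnSeries Γ K) vec c) = c
  coord_eq_zero : ∀ j, j ≠ k → ∀ x ∈ X.grading j, coord x = 0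

theorem isCompl_grading (X : QuantumCorrection K Γ S) (k : S) :
    IsCompl (X.grading k) (⨆ j ∈ {j : S | j ≠ k}, X.grading j) := by
  refine ⟨X.grading_indep k, codisjoint_iff.mpr (eq_top_iff.mpr ?_)⟩
  rw [← X.grading_total]
  refine iSup_le fun j => ?_
  by_cases h : j = k
  · exact h ▸ le_sup_left
  · exact le_sup_of_le_right (le_iSup₂_of_le j h le_rfl)

theorem nonempty_frame (X : QuantumCorrection K Γ S) (k : S) : Nonempty (X.Frame k) := by
  obtain ⟨n, v, -, hK, -, hL, hli⟩ := X.lattice k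
  obtain ⟨r, hr⟩ := (Fintype.linearCombination (HahnSeries Γ K) v).exists_leftInverse_of_injective
    (LinearMap.ker_eq_bot.mpr (hli.fintypeLinearCombination_injective))
  let proj := (X.grading k).projectionOnto _ (X.isCompl_grading k)
  refine ⟨n, v, r ∘ₗ (X.grading k).subtype ∘ₗ proj, hK, hL, fun c => ?_, fun j hj x hx => ?_⟩
  · have hc : Fintype.linearCombination (HahnSeries Γ K) v c ∈ X.grading k := by
      rw [← hL, ← Fintype.range_linearCombination]
      exact LinearMap.mem_range_self _ c
    have hproj : proj (Fintype.linearCombination (HahnSeries Γ K) v c) = ⟨_, hc⟩ :=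
      Submodule.projectionOnto_apply_left (X.isCompl_grading k) ⟨_, hc⟩
    rw [LinearMap.comp_apply, LinearMap.comp_apply, hproj]
    exact LinearMap.congr_fun hr c
  · have hproj : proj x = 0 := (Submodule.projectionOnto_apply_eq_zero_iff _).mpr
      (Submodule.mem_iSup_of_mem j (Submodule.mem_iSup_of_mem hj hx))
    simp [hproj]

/-- If `d x ∈ C_k`, the component of `x` in `C_{k+1}` has the same boundary. -/
theorem exists_mem_grading_d_eq (X : QuantumCorrection K Γ S) {k : S} {x : X.C}
    (hx : X.d x ∈ X.grading k) : ∃ y ∈ X.grading ((1 : ℤ) +ᵥ k), X.d y = X.d x := by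
  obtain ⟨a, ha, b, hb, rfl⟩ := Submodule.mem_sup.mp
    ((X.isCompl_grading ((1 : ℤ) +ᵥ k)).sup_eq_top ▸ Submodule.mem_top (x := x))
  have hda : X.d a ∈ X.grading k := by
    simpa [vadd_vadd] using X.d_grading _ (Submodule.mem_map_of_mem ha)
  have hdb : X.d b ∈ ⨆ j ∈ {j : S | j ≠ k}, X.grading j := by
    have hle : (⨆ j ∈ {j : S | j ≠ (1 : ℤ) +ᵥ k}, X.grading j) ≤
        (⨆ j ∈ {j : S | j ≠ k}, X.grading j).comap X.d := by
      refine iSup₂_le fun j hj => Submodule.map_le_iff_le_comap.mp ((X.d_grading j).trans ?_)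
      refine le_iSup₂_of_le ((-1 : ℤ) +ᵥ j) (fun h => hj ?_) le_rfl
      rw [← h, vadd_vadd]
      simp
    exact hle hb
  have hdb' : X.d b ∈ X.grading k := by
    rw [map_add] at hx
    exact (Submodule.add_mem_iff_right _ hda).mp hx
  refine ⟨a, ha, ?_⟩
  rw [map_add, Submodule.disjoint_def.mp (X.grading_indep k) _ hdb' hdb, add_zero]

namespace Frame

variable {X : QuantumCorrection K Γ S} {k : S} (F : X.Frame k)

theorem linearCombination_mem_grading (c : Fin F.n → HahnSeries Γ K) :
    Fintype.linearCombination (HahnSeries Γ K) F.vec c ∈ X.grading k := by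
  rw [← F.span_grading, ← Fintype.range_linearCombination]
  exact LinearMap.mem_range_self _ c

theorem linearCombination_injective :
    Function.Injective (Fintype.linearCombination (HahnSeries Γ K) F.vec) :=
  Function.LeftInverse.injective F.coord_linearCombination

theorem linearCombination_coord {x : X.C} (hx : x ∈ X.grading k) :
    Fintype.linearCombination (HahnSeries Γ K) F.vec (F.coord x) = x := by
  rw [← F.span_grading, ← Fintype.range_linearCombination] at hx
  obtain ⟨c, rfl⟩ := hx
  rw [F.coord_linearCombination]

theorem linearCombination_eq (a : Fin F.n → K) :
    Fintype.linearCombination K F.vec a =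
      Fintype.linearCombination (HahnSeries Γ K) F.vec (fun i => HahnSeries.C (a i)) := by
  simp only [Fintype.linearCombination_apply, X.smul_eq_C_smul]

theorem coord_linearCombination_field (a : Fin F.n → K) :
    F.coord (Fintype.linearCombination K F.vec a) = fun i => HahnSeries.C (a i) := by
  rw [F.linearCombination_eq, F.coord_linearCombination]

theorem linearCombination_field_injective :
    Function.Injective (Fintype.linearCombination K F.vec) := fun a b hab => by
  have h := congrArg F.coord hab
  simp only [F.coord_linearCombination_field] at h
  exact funext fun i => HahnSeries.C_injective (congrFun h i)

theorem exists_coord_eq_of_mem_gbar {z : X.C} (hz : z ∈ X.gbar k) :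
    ∃ a : Fin F.n → K, F.coord z = fun i => HahnSeries.C (a i) := by
  rw [← F.span_gbar, ← Fintype.range_linearCombination] at hz
  obtain ⟨a, rfl⟩ := hz
  exact ⟨a, F.coord_linearCombination_field a⟩

theorem gbar_le_grading (F : X.Frame k) : X.gbar k ≤ (X.grading k).restrictScalars K := by
  rw [← F.span_gbar, ← Fintype.range_linearCombination]
  rintro _ ⟨a, rfl⟩
  rw [F.linearCombination_eq]
  exact F.linearCombination_mem_grading _

theorem exists_coord_eq_of_mem_iSup_gbar {z : X.C} (hz : z ∈ ⨆ j, X.gbar j) :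
    ∃ a : Fin F.n → K, F.coord z = fun i => HahnSeries.C (a i) := by
  induction hz using Submodule.iSup_induction' with
  | mem j x hx =>
    by_cases hj : j = k
    · subst hj
      exact F.exists_coord_eq_of_mem_gbar hx
    · obtain ⟨G⟩ := X.nonempty_frame j
      exact ⟨0, by rw [F.coord_eq_zero j hj x (G.gbar_le_grading hx)]; ext; simp⟩
  | zero => exact ⟨0, by rw [map_zero]; ext; simp⟩
  | add x y _ _ hx hy =>
    obtain ⟨a, ha⟩ := hx
    obtain ⟨b, hb⟩ := hy
    exact ⟨a + b, by rw [map_add, ha, hb]; ext; simp⟩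

theorem vanishesBelow_coord_of_mem_closure {B : Submodule K X.C}
    (hB : ∀ z ∈ B, ∃ a : Fin F.n → K, F.coord z = fun i => HahnSeries.C (a i)) {m : ℝ} {y : X.C}
    (hy : y ∈ AddSubgroup.closure {y : X.C | ∃ (lam : HahnSeries Γ K) (z : X.C), z ∈ B ∧
      (m : EReal) ≤ novikovVal lam ∧ y = lam • z}) :
    VanishesBelow m (F.coord y) := by
  induction hy using AddSubgroup.closure_induction with
  | mem y hy =>
    obtain ⟨lam, z, hz, hlam, rfl⟩ := hy
    obtain ⟨a, ha⟩ := hB z hz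
    intro g hg
    ext i
    simp [ha, mul_comm lam, coe_le_novikovVal_iff.mp hlam g hg]
  | zero => intro g _; simp
  | add x y _ _ hx hy => intro g hg; rw [map_add, map_add, hx g hg, hy g hg, add_zero]
  | neg x _ hx => intro g hg; rw [map_neg, map_neg, hx g hg, neg_zero]

theorem le_nubar_iff {y : X.C} (hy : y ∈ X.grading k) (m : ℝ) :
    (m : EReal) ≤ X.nubar y ↔ VanishesBelow m (F.coord y) := by
  constructor
  · intro h g hg
    obtain ⟨_, ⟨m', rfl, hm'⟩, hlt⟩ :=
      lt_sSup_iff.mp ((EReal.coe_lt_coe_iff.mpr hg).trans_le h)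
    exact F.vanishesBelow_coord_of_mem_closure (fun _ => F.exists_coord_eq_of_mem_iSup_gbar) hm' g
      (EReal.coe_lt_coe_iff.mp hlt)
  · intro h
    refine le_sSup ⟨m, rfl, ?_⟩
    rw [← F.linearCombination_coord hy, Fintype.linearCombination_apply]
    refine sum_mem fun i _ => AddSubgroup.subset_closure ⟨_, _, ?_, ?_, rfl⟩
    · refine Submodule.mem_iSup_of_mem k ?_
      rw [← F.span_gbar]
      exact Submodule.subset_span (Set.mem_range_self i)
    · exact coe_le_novikovVal_iff.mpr fun g hg => congrFun (h g hg) i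

theorem mem_filt_iff {y : X.C} {lam : ℝ} :
    y ∈ X.filt k lam ↔ y ∈ X.grading k ∧ VanishesBelow (-lam) (F.coord y) :=
  and_congr_right fun hy => F.le_nubar_iff hy _

theorem linearCombination_mem_filt_iff {c : Fin F.n → HahnSeries Γ K} {lam : ℝ} :
    Fintype.linearCombination (HahnSeries Γ K) F.vec c ∈ X.filt k lam ↔
      VanishesBelow (-lam) c := by
  rw [F.mem_filt_iff, F.coord_linearCombination,
    and_iff_right (F.linearCombination_mem_grading c)]

variable (G : X.Frame ((1 : ℤ) +ᵥ k))

/-- The matrix of `∂ : C_{k+1} → C_k` as a map of coordinate vectors. -/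
def dCoord : (Fin G.n → HahnSeries Γ K) →ₗ[HahnSeries Γ K] (Fin F.n → HahnSeries Γ K) :=
  F.coord ∘ₗ X.d ∘ₗ Fintype.linearCombination (HahnSeries Γ K) G.vec

theorem d_linearCombination (c : Fin G.n → HahnSeries Γ K) :
    X.d (Fintype.linearCombination (HahnSeries Γ K) G.vec c) =
      Fintype.linearCombination (HahnSeries Γ K) F.vec (F.dCoord G c) := by
  refine (F.linearCombination_coord ?_).symm
  simpa [vadd_vadd] using
    X.d_grading _ (Submodule.mem_map_of_mem (G.linearCombination_mem_grading c))

theorem exists_d0Coord : ∃ A : (Fin G.n → K) →ₗ[K] (Fin F.n → K), ∀ a,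
    X.d0 (Fintype.linearCombination K G.vec a) = Fintype.linearCombination K F.vec (A a) := by
  obtain ⟨r, hr⟩ := (Fintype.linearCombination K F.vec).exists_leftInverse_of_injective
    (LinearMap.ker_eq_bot.mpr F.linearCombination_field_injective)
  refine ⟨r ∘ₗ X.d0 ∘ₗ Fintype.linearCombination K G.vec, fun a => ?_⟩
  have hmem : X.d0 (Fintype.linearCombination K G.vec a) ∈ X.gbar k := by
    have ha : Fintype.linearCombination K G.vec a ∈ X.gbar ((1 : ℤ) +ᵥ k) := by
      rw [← G.span_gbar, ← Fintype.range_linearCombination]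
      exact LinearMap.mem_range_self _ a
    simpa [vadd_vadd] using X.d0_gbar _ (Submodule.mem_map_of_mem ha)
  rw [← F.span_gbar, ← Fintype.range_linearCombination] at hmem
  obtain ⟨b, hb⟩ := hmem
  rw [LinearMap.comp_apply, LinearMap.comp_apply, ← hb]
  exact congrArg _ (LinearMap.congr_fun hr b).symm

theorem finrank_map_d :
    Module.finrank (HahnSeries Γ K) ↥((X.grading ((1 : ℤ) +ᵥ k)).map X.d) =
      Module.finrank (HahnSeries Γ K) (LinearMap.range (F.dCoord G)) := by
  have : (X.grading ((1 : ℤ) +ᵥ k)).map X.d =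
      (LinearMap.range (F.dCoord G)).map (Fintype.linearCombination (HahnSeries Γ K) F.vec) := by
    rw [← G.span_grading, ← Fintype.range_linearCombination, ← LinearMap.range_comp,
      ← LinearMap.range_comp]
    exact congrArg _ (LinearMap.ext (F.d_linearCombination G))
  rw [this]
  exact (Submodule.equivMapOfInjective _ F.linearCombination_injective _).finrank_eq.symm

theorem finrank_map_d0 {A : (Fin G.n → K) →ₗ[K] (Fin F.n → K)}
    (hA : ∀ a, X.d0 (Fintype.linearCombination K G.vec a) =
      Fintype.linearCombination K F.vec (A a)) :
    Module.finrank K ↥((X.gbar ((1 : ℤ) +ᵥ k)).map X.d0) =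
      Module.finrank K (LinearMap.range A) := by
  have : (X.gbar ((1 : ℤ) +ᵥ k)).map X.d0 =
      (LinearMap.range A).map (Fintype.linearCombination K F.vec) := by
    rw [← G.span_gbar, ← Fintype.range_linearCombination, ← LinearMap.range_comp,
      ← LinearMap.range_comp]
    exact congrArg _ (LinearMap.ext hA)
  rw [this]
  exact (Submodule.equivMapOfInjective _ F.linearCombination_field_injective _).finrank_eq.symm

theorem isCorrection_dCoord {A : (Fin G.n → K) →ₗ[K] (Fin F.n → K)}
    (hA : ∀ a, X.d0 (Fintype.linearCombination K G.vec a) =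
      Fintype.linearCombination K F.vec (A a)) :
    IsCorrection A (F.dCoord G) (X.μ k) := by
  intro m y hy g hg
  have hvec : ∀ j, ∃ e, VanishesBelow (X.μ k) e ∧ F.coord (X.d (G.vec j)) =
      (fun i => HahnSeries.C (A (Pi.single j 1) i)) + e := fun j => by
    refine ⟨F.coord (X.d (G.vec j) - X.d0 (G.vec j)), ?_, ?_⟩
    · refine F.vanishesBelow_coord_of_mem_closure (B := X.gbar k)
        (fun _ => F.exists_coord_eq_of_mem_gbar) (X.gap k _ ?_)
      rw [← G.span_gbar]
      exact Submodule.subset_span (Set.mem_range_self j)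
    · have h0 := hA (Pi.single j 1)
      rw [Fintype.linearCombination_apply_single, one_smul] at h0
      rw [← F.coord_linearCombination_field, ← h0, ← map_add, add_sub_cancel]
  choose e he hde using hvec
  have hD : F.dCoord G y = ∑ j, y j • F.coord (X.d (G.vec j)) := by
    simp [dCoord, Fintype.linearCombination_apply, map_sum]
  ext i
  rw [LinearMap.pi_apply_eq_sum_univ A, hD, map_sum, Finset.sum_apply, Finset.sum_apply]
  refine Finset.sum_congr rfl fun j _ => ?_
  have herr : (y j * e j i).coeff g = 0 :=
    coeff_mul_eq_zero_of_lt_add (fun g hg => congrFun (hy g hg) j)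
      (fun g hg => congrFun (he j g hg) i) g hg
  have hsingle : (fun l => if j = l then (1 : K) else 0) = Pi.single j 1 := by
    ext l
    simp [Pi.single_apply, eq_comm]
  simp [hde, herr, mul_comm ((y j).coeff g), hsingle]

end Frame

/-- For a quantum correction `(C,∂)` of `(C̄,∂₀)` of gap at least `μ` and each `k ∈ S`:
`rank(∂₀|_{C̄_{k+1}}) ≤ rank(∂|_{C_{k+1}})`; if these ranks are equal then
`b_k(C,∂) = 0`; and if `rank(∂₀|_{C̄_{k+1}}) < rank(∂|_{C_{k+1}})` then
`b_k(C,∂) ≥ μ(k)`. -/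
theorem rank_le_and_bdepth_alternative (X : QuantumCorrection K Γ S) (k : S) :
    Module.finrank K ↥((X.gbar ((1 : ℤ) +ᵥ k)).map X.d0) ≤
      Module.finrank (HahnSeries Γ K) ↥((X.grading ((1 : ℤ) +ᵥ k)).map X.d) ∧
    (Module.finrank K ↥((X.gbar ((1 : ℤ) +ᵥ k)).map X.d0) =
        Module.finrank (HahnSeries Γ K) ↥((X.grading ((1 : ℤ) +ᵥ k)).map X.d) →
      X.bdepth k = 0) ∧
    (Module.finrank K ↥((X.gbar ((1 : ℤ) +ᵥ k)).map X.d0) <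
        Module.finrank (HahnSeries Γ K) ↥((X.grading ((1 : ℤ) +ᵥ k)).map X.d) →
      ((X.μ k : ℝ) : EReal) ≤ X.bdepth k) := by
  obtain ⟨F⟩ := X.nonempty_frame k
  obtain ⟨G⟩ := X.nonempty_frame ((1 : ℤ) +ᵥ k)
  obtain ⟨A, hA⟩ := F.exists_d0Coord G
  have hcorr := F.isCorrection_dCoord G hA
  rw [F.finrank_map_d0 G hA, F.finrank_map_d G]
  refine ⟨hcorr.finrank_range_le (X.μ_pos k), fun heq => ?_, fun hlt => ?_⟩
  · refine le_antisymm (sInf_le ⟨0, rfl, le_rfl, ?_⟩) (le_sInf ?_)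
    · rintro lam _ hx ⟨y, rfl⟩
      obtain ⟨hgr, hvan⟩ := F.mem_filt_iff.mp hx
      obtain ⟨y', hy', hd⟩ := X.exists_mem_grading_d_eq hgr
      have hrange : F.coord (X.d y) ∈ LinearMap.range (F.dCoord G) := by
        refine ⟨G.coord y', F.linearCombination_injective ?_⟩
        rw [← F.d_linearCombination, G.linearCombination_coord hy', hd,
          F.linearCombination_coord hgr]
      obtain ⟨c, hc, hDc⟩ := hcorr.exists_preimage_of_finrank_eq (X.μ_pos k) heq hrange hvan
      refine ⟨Fintype.linearCombination (HahnSeries Γ K) G.vec c, ?_, ?_⟩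
      · rwa [add_zero, G.linearCombination_mem_filt_iff]
      · rw [F.d_linearCombination, hDc, F.linearCombination_coord hgr]
    · rintro _ ⟨β, rfl, hβ, -⟩
      exact_mod_cast hβ
  · refine le_sInf ?_
    rintro _ ⟨β, rfl, -, hβ⟩
    rw [EReal.coe_le_coe_iff]
    by_contra! hβμ
    refine hlt.not_ge (hcorr.finrank_range_le_of_forall_exists_preimage hβμ ?_)
    rintro m _ ⟨c, rfl⟩ hm
    obtain ⟨y, hy, hdy⟩ := hβ (-m) (Fintype.linearCombination (HahnSeries Γ K) F.vec
      (F.dCoord G c)) (F.linearCombination_mem_filt_iff.mpr (by rwa [neg_neg]))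
      ⟨_, F.d_linearCombination G c⟩
    obtain ⟨hgr, hvan⟩ := G.mem_filt_iff.mp hy
    refine ⟨G.coord y, ?_, F.linearCombination_injective ?_⟩
    · rwa [neg_add, neg_neg, ← sub_eq_add_neg] at hvan
    · rw [← F.d_linearCombination, G.linearCombination_coord hgr, hdy]

end QuantumCorrection

end
end

section
/- Let Γ ≤ Γ' ≤ ℝ be additive subgroups, Λ = Λ^{K,Γ}, Λ' = Λ^{K,Γ'}, let (C₀,ℓ₀), (C₁,ℓ₁) be finite-dimensional filtered Λ-vector spaces, and let A: C₀ → C₁ be Λ-linear. For any y ∈ C₀ ⊗_Λ Λ' with 0 ≠ (A⊗1)y ∈ C₁, there exists y₀ ∈ C₀ with A y₀ = (A⊗1)y and ℓ₀(y₀) ≤ ℓ₀(y). Consequently, for any nonzero x ∈ Im A, inf{ℓ₀(y) : y ∈ C₀, Ay = x} = inf{ℓ₀(y) : y ∈ C₀⊗_Λ Λ', (A⊗1)y = x}. -/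
noncomputable section
/-- The filtration function of a finite-dimensional filtered `Λ`-vector space, written in
coordinates with respect to an orthogonal basis of filtration levels `c`:
`ℓ(Σ λ_i x_i) = max_i (ℓ(x_i) − ν(λ_i))`. -/
def filtLevel {K : Type*} [Field K] {Γ : AddSubgroup ℝ} {m : ℕ} (c : Fin m → ℝ)
    (v : Fin m → HahnSeries Γ K) : EReal :=
  ⨆ i, ((c i : EReal) - novikovVal (v i))

/-- The coefficient-extension ring homomorphism `Λ^{K,Γ} → Λ^{K,Γ'}` for `Γ ≤ Γ' ≤ ℝ`. -/
def novikovExt (K : Type*) [Field K] {Γ Γ' : AddSubgroup ℝ} (h : Γ ≤ Γ') :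
    HahnSeries Γ K →+* HahnSeries Γ' K :=
  HahnSeries.embDomainRingHom (AddSubgroup.inclusion h)
    (AddSubgroup.inclusion_injective h) (fun _ _ => Iff.rfl)

/-- The valuation is the greatest lower bound of the exponents that occur. -/
theorem le_novikovVal_iff {K : Type*} [Field K] {Γ : AddSubgroup ℝ} (a : HahnSeries Γ K)
    (e : EReal) : e ≤ novikovVal a ↔ ∀ g : Γ, a.coeff g ≠ 0 → e ≤ ((g : ℝ) : EReal) := by
  unfold novikovVal
  split_ifs with ha
  · simp [ha]
  · refine ⟨fun he g hg => he.trans ?_, fun he => he _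
      (HahnSeries.coeff_orderTop_ne (HahnSeries.order_eq_orderTop_of_ne_zero ha).symm)⟩
    exact_mod_cast HahnSeries.order_le_of_coeff_ne_zero hg

/-- The projection `Λ^{K,Γ'} → Λ^{K,Γ}` that forgets the terms with exponent outside `Γ`. -/
def novikovRestrict {K : Type*} [Field K] {Γ Γ' : AddSubgroup ℝ} (h : Γ ≤ Γ') :
    HahnSeries Γ' K →+ HahnSeries Γ K where
  toFun b :=
    { coeff := fun g => b.coeff (AddSubgroup.inclusion h g)
      isPWO_support' := fun f => b.isPWO_support
        (fun k => ⟨AddSubgroup.inclusion h (f k), (f k).2⟩) }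
  map_zero' := by ext; simp
  map_add' a b := by ext; simp

theorem novikovRestrict_coeff {K : Type*} [Field K] {Γ Γ' : AddSubgroup ℝ} (h : Γ ≤ Γ')
    (b : HahnSeries Γ' K) (g : Γ) :
    (novikovRestrict h b).coeff g = b.coeff (AddSubgroup.inclusion h g) := rfl

theorem novikovExt_coeff {K : Type*} [Field K] {Γ Γ' : AddSubgroup ℝ} (h : Γ ≤ Γ')
    (a : HahnSeries Γ K) (g : Γ) :
    (novikovExt K h a).coeff (AddSubgroup.inclusion h g) = a.coeff g :=
  HahnSeries.embDomain_coeff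
    (f := ⟨⟨AddSubgroup.inclusion h, AddSubgroup.inclusion_injective h⟩, Iff.rfl⟩)

theorem exists_of_novikovExt_coeff_ne_zero {K : Type*} [Field K] {Γ Γ' : AddSubgroup ℝ}
    (h : Γ ≤ Γ') {a : HahnSeries Γ K} {g : Γ'} (hg : (novikovExt K h a).coeff g ≠ 0) :
    ∃ g₀ : Γ, AddSubgroup.inclusion h g₀ = g ∧ a.coeff g₀ ≠ 0 := by
  by_contra! hne
  refine hg (HahnSeries.embDomain_notin_image_support
    (f := ⟨⟨AddSubgroup.inclusion h, AddSubgroup.inclusion_injective h⟩, Iff.rfl⟩) ?_)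
  rintro ⟨g₀, hg₀, rfl⟩
  exact hg₀ (hne g₀ rfl)

theorem novikovRestrict_novikovExt {K : Type*} [Field K] {Γ Γ' : AddSubgroup ℝ} (h : Γ ≤ Γ')
    (a : HahnSeries Γ K) : novikovRestrict h (novikovExt K h a) = a := by
  ext g
  rw [novikovRestrict_coeff, novikovExt_coeff]

/-- The projection to `Λ^{K,Γ}` is `Λ^{K,Γ}`-linear. -/
theorem novikovRestrict_mul {K : Type*} [Field K] {Γ Γ' : AddSubgroup ℝ} (h : Γ ≤ Γ')
    (a : HahnSeries Γ K) (b : HahnSeries Γ' K) :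
    novikovRestrict h (novikovExt K h a * b) = a * novikovRestrict h b := by
  ext g
  rw [novikovRestrict_coeff, HahnSeries.coeff_mul, HahnSeries.coeff_mul]
  symm
  refine Finset.sum_bij
    (fun p _ => (AddSubgroup.inclusion h p.1, AddSubgroup.inclusion h p.2)) ?_ ?_ ?_ ?_
  · intro p hp
    rw [Finset.mem_antidiagonal] at hp ⊢
    obtain ⟨h1, h2, h3⟩ := hp
    refine ⟨?_, h2, ?_⟩
    · rwa [HahnSeries.mem_support, novikovExt_coeff]
    · rw [← h3, map_add]
  · intro p _ q _ hpq
    rw [Prod.mk.injEq] at hpq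
    exact Prod.ext (AddSubgroup.inclusion_injective h hpq.1)
      (AddSubgroup.inclusion_injective h hpq.2)
  · rintro ⟨i, j⟩ hp
    rw [Finset.mem_antidiagonal] at hp
    obtain ⟨h1, h2, h3⟩ := hp
    obtain ⟨i, rfl, hi⟩ := exists_of_novikovExt_coeff_ne_zero h h1
    have hj : j = AddSubgroup.inclusion h (g - i) := by
      rw [map_sub]
      exact eq_sub_of_add_eq' h3
    subst hj
    exact ⟨(i, g - i), Finset.mem_antidiagonal.2 ⟨hi, h2, add_sub_cancel i g⟩, rfl⟩
  · intro p _
    rw [novikovExt_coeff, novikovRestrict_coeff]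

theorem mulVec_novikovRestrict {K : Type*} [Field K] {Γ Γ' : AddSubgroup ℝ} (h : Γ ≤ Γ')
    {m n : ℕ} (M : Matrix (Fin n) (Fin m) (HahnSeries Γ K)) (y : Fin m → HahnSeries Γ' K) :
    M.mulVec (novikovRestrict h ∘ y) =
      novikovRestrict h ∘ (M.map (novikovExt K h)).mulVec y := by
  ext1 i
  simp [Matrix.mulVec, dotProduct, map_sum, novikovRestrict_mul]

theorem filtLevel_mono {K : Type*} [Field K] {Γ Γ' : AddSubgroup ℝ} {m : ℕ} (c : Fin m → ℝ)
    {v : Fin m → HahnSeries Γ K} {w : Fin m → HahnSeries Γ' K}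
    (hvw : ∀ i, novikovVal (w i) ≤ novikovVal (v i)) : filtLevel c v ≤ filtLevel c w :=
  iSup_mono fun i => EReal.sub_le_sub le_rfl (hvw i)

theorem filtLevel_novikovRestrict_le {K : Type*} [Field K] {Γ Γ' : AddSubgroup ℝ} (h : Γ ≤ Γ')
    {m : ℕ} (c : Fin m → ℝ) (y : Fin m → HahnSeries Γ' K) :
    filtLevel c (novikovRestrict h ∘ y) ≤ filtLevel c y :=
  filtLevel_mono c fun i => (le_novikovVal_iff _ _).2 fun g hg =>
    (le_novikovVal_iff (y i) _).1 le_rfl (AddSubgroup.inclusion h g) hg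

theorem filtLevel_novikovExt_le {K : Type*} [Field K] {Γ Γ' : AddSubgroup ℝ} (h : Γ ≤ Γ')
    {m : ℕ} (c : Fin m → ℝ) (y : Fin m → HahnSeries Γ K) :
    filtLevel c (novikovExt K h ∘ y) ≤ filtLevel c y := by
  refine filtLevel_mono c fun i => (le_novikovVal_iff _ _).2 fun g hg => ?_
  obtain ⟨g₀, rfl, hg₀⟩ := exists_of_novikovExt_coeff_ne_zero h hg
  exact (le_novikovVal_iff (y i) _).1 le_rfl g₀ hg₀

/-- Coefficient extension and filtration levels: let `Γ ≤ Γ' ≤ ℝ`, `Λ = Λ^{K,Γ}`,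
`Λ' = Λ^{K,Γ'}`, let `C₀ = Λ^m`, `C₁ = Λ^n` be finite-dimensional filtered `Λ`-vector
spaces (in coordinates with respect to orthogonal bases, with `ℓ₀` determined by the
levels `c : Fin m → ℝ`), and let `A : C₀ → C₁` be the `Λ`-linear map with matrix `M`.
Then for any `y ∈ C₀ ⊗_Λ Λ'` with `0 ≠ (A⊗1)y ∈ C₁` there is `y₀ ∈ C₀` with
`A y₀ = (A⊗1)y` and `ℓ₀(y₀) ≤ ℓ₀(y)`; consequently, for every nonzero `x ∈ Im A`,
`inf {ℓ₀(y) : y ∈ C₀, Ay = x} = inf {ℓ₀(y) : y ∈ C₀ ⊗_Λ Λ', (A⊗1)y = x}`. -/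
theorem filtLevel_extension (K : Type*) [Field K] {Γ Γ' : AddSubgroup ℝ} (h : Γ ≤ Γ')
    (m n : ℕ) (M : Matrix (Fin n) (Fin m) (HahnSeries Γ K)) (c : Fin m → ℝ) :
    (∀ y : Fin m → HahnSeries Γ' K,
      (∃ x : Fin n → HahnSeries Γ K, (M.map (novikovExt K h)).mulVec y = (novikovExt K h) ∘ x) →
      (M.map (novikovExt K h)).mulVec y ≠ 0 →
      ∃ y₀ : Fin m → HahnSeries Γ K,
        (novikovExt K h) ∘ (M.mulVec y₀) = (M.map (novikovExt K h)).mulVec y ∧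
        filtLevel c y₀ ≤ filtLevel c y) ∧
    (∀ x : Fin n → HahnSeries Γ K, x ≠ 0 → (∃ y, M.mulVec y = x) →
      sInf {e : EReal | ∃ y : Fin m → HahnSeries Γ K, M.mulVec y = x ∧ e = filtLevel c y} =
      sInf {e : EReal | ∃ y : Fin m → HahnSeries Γ' K,
        (M.map (novikovExt K h)).mulVec y = (novikovExt K h) ∘ x ∧ e = filtLevel c y}) := by
  have descend : ∀ (y : Fin m → HahnSeries Γ' K) (x : Fin n → HahnSeries Γ K),
      (M.map (novikovExt K h)).mulVec y = novikovExt K h ∘ x →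
      M.mulVec (novikovRestrict h ∘ y) = x := by
    intro y x hx
    rw [mulVec_novikovRestrict, hx]
    exact funext fun i => novikovRestrict_novikovExt h (x i)
  refine ⟨?_, ?_⟩
  · rintro y ⟨x, hx⟩ -
    exact ⟨novikovRestrict h ∘ y, by rw [descend y x hx, hx], filtLevel_novikovRestrict_le h c y⟩
  · intro x _ _
    apply le_antisymm
    · refine le_sInf ?_
      rintro _ ⟨y, hy, rfl⟩
      exact sInf_le_of_le ⟨_, descend y x hy, rfl⟩ (filtLevel_novikovRestrict_le h c y)
    · refine le_sInf ?_
      rintro _ ⟨y, rfl, rfl⟩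
      refine sInf_le_of_le ⟨novikovExt K h ∘ y, ?_, rfl⟩ (filtLevel_novikovExt_le h c y)
      exact funext fun i => (RingHom.map_mulVec (novikovExt K h) M y i).symm

end
end
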